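/- arXiv:math/0209151 — 7 statements merged into one kernel-verified Lean document; each statement's English description precedes it below -/
import Mathlib

section
/- Let k be a field, V a finite-dimensional k-vector space, B a nondegenerate bilinear form on V, and f a diagonalizable linear endomorphism of V satisfying B(f(u), f(v)) = B(u, v) for all u, v ∈ V. Then the restriction of B to the fixed subspace {v ∈ V | f(v) = v} (the eigenspace of f for the eigenvalue 1) is again nondegenerate. -/
/-- An `f`-invariant linear functional that vanishes on the fixed vectors of a diagonalizable
endomorphism `f` is zero. -/
theorem Module.End.eq_zero_of_invariant_of_vanish_on_fixed {k V : Type*} [Field k]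
    [AddCommGroup V] [Module k V] {f : Module.End k V}
    (hdiag : ⨆ μ : k, f.eigenspace μ = ⊤) {φ : V →ₗ[k] k}
    (hinv : ∀ v, φ (f v) = φ v) (hfix : ∀ v, f v = v → φ v = 0) : φ = 0 := by
  rw [← LinearMap.ker_eq_top, eq_top_iff, ← hdiag, iSup_le_iff]
  intro μ v hv
  rw [Module.End.mem_eigenspace_iff] at hv
  rw [LinearMap.mem_ker]
  by_cases hμ : μ = 1
  · exact hfix v (by rw [hv, hμ, one_smul])
  · have h := hinv v
    rw [hv, map_smul, smul_eq_mul, mul_left_eq_self₀] at h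
    exact h.resolve_left hμ

/-- Let `k` be a field, `V` a finite-dimensional `k`-vector space, `B` a nondegenerate
bilinear form on `V`, and `f` a diagonalizable linear endomorphism of `V` satisfying
`B (f u) (f v) = B u v` for all `u v : V`.  Then the restriction of `B` to the fixed
subspace `{v | f v = v}` (the eigenspace of `f` for the eigenvalue `1`) is again
nondegenerate. -/
theorem stmt0 (k V : Type*) [Field k] [AddCommGroup V] [Module k V]
    [FiniteDimensional k V]
    (B : V →ₗ[k] V →ₗ[k] k)
    (hB_left : ∀ u : V, (∀ v : V, B u v = 0) → u = 0)
    (hB_right : ∀ v : V, (∀ u : V, B u v = 0) → v = 0)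
    (f : Module.End k V)
    (hdiag : ⨆ μ : k, f.eigenspace μ = ⊤)
    (hinv : ∀ u v : V, B (f u) (f v) = B u v) :
    (∀ u : V, f u = u → (∀ v : V, f v = v → B u v = 0) → u = 0) ∧
    (∀ v : V, f v = v → (∀ u : V, f u = u → B u v = 0) → v = 0) := by
  refine ⟨fun u hu h => hB_left u fun v => ?_, fun v hv h => hB_right v fun u => ?_⟩
  · exact LinearMap.congr_fun (Module.End.eq_zero_of_invariant_of_vanish_on_fixed hdiag
      (φ := B u) (fun w => by simpa only [hu] using hinv u w) h) v
  · exact LinearMap.congr_fun (Module.End.eq_zero_of_invariant_of_vanish_on_fixed hdiag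
      (φ := B.flip v) (fun w => by simpa only [hv, LinearMap.flip_apply] using hinv w v) h) u
end

section
/- Let k be an algebraically closed field of characteristic p > 0, V a finite-dimensional k-vector space, f a semisimple linear endomorphism of V, and q = p^n for some natural number n. Then for every linear endomorphism g of V, g commutes with f if and only if g commutes with f^q. (Equivalently: the centralizer of f in End(V), and hence also in GL(V), equals the centralizer of f^q.) -/
/-- In exponential characteristic `p`, an endomorphism commuting with `f ^ p ^ n` preserves
the eigenspaces of a semisimple endomorphism `f`. -/
theorem Module.End.IsSemisimple.map_mem_eigenspace_of_commute_pow {k V : Type*} [Field k]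
    [AddCommGroup V] [Module k V] {p n : ℕ} [ExpChar k p] {f g : Module.End k V}
    (hf : f.IsSemisimple) (hg : Commute g (f ^ p ^ n)) {μ : k} {v : V}
    (hv : v ∈ f.eigenspace μ) : g v ∈ f.eigenspace μ := by
  rcases subsingleton_or_nontrivial V with hV | hV
  · rw [Subsingleton.elim (g v) v]
    exact hv
  have : ExpChar (Module.End k V) p :=
    expChar_of_injective_algebraMap (algebraMap k (Module.End k V)).injective p
  have hpow : (f - algebraMap k (Module.End k V) μ) ^ p ^ n =
      f ^ p ^ n - algebraMap k (Module.End k V) (μ ^ p ^ n) := by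
    rw [sub_pow_expChar_pow_of_commute _ _ (Algebra.commutes μ f).symm, map_pow]
  have hcomm : Commute g ((f - algebraMap k (Module.End k V) μ) ^ p ^ n) := by
    rw [hpow]
    exact hg.sub_right (Algebra.commutes _ g).symm
  have hv0 : (f - algebraMap k (Module.End k V) μ) v = 0 := by
    simpa [Module.End.mem_eigenspace_iff, sub_eq_zero] using hv
  rw [← hf.isFinitelySemisimple.maxGenEigenspace_eq_eigenspace μ,
    Module.End.mem_maxGenEigenspace]
  refine ⟨p ^ n, ?_⟩
  rw [← Algebra.algebraMap_eq_smul_one, ← Module.End.mul_apply, ← hcomm.eq,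
    Module.End.mul_apply, Module.End.pow_map_zero_of_le
      (Nat.one_le_pow n p (expChar_pos k p)) (by simpa using hv0), map_zero]

/-- Let `k` be an algebraically closed field of characteristic `p > 0`, `V` a
finite-dimensional `k`-vector space, `f` a semisimple endomorphism of `V`, and
`q = p ^ n`.  Then an endomorphism `g` commutes with `f` iff it commutes with `f ^ q`. -/
theorem stmt2 (k V : Type*) [Field k] [IsAlgClosed k] [AddCommGroup V] [Module k V]
    [FiniteDimensional k V]
    (p : ℕ) (hp : 0 < p) [CharP k p]
    (f : Module.End k V) (hf : f.IsSemisimple) (n : ℕ) :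
    ∀ g : Module.End k V, Commute g f ↔ Commute g (f ^ p ^ n) := by
  refine fun g ↦ ⟨fun h ↦ h.pow_right _, fun hg ↦ LinearMap.ext fun v ↦ ?_⟩
  have : NeZero p := ⟨hp.ne'⟩
  have : Fact p.Prime := CharP.char_is_prime_of_pos k p
  have hv : v ∈ ⨆ μ, f.eigenspace μ := hf.iSup_eigenspace_eq_top ▸ Submodule.mem_top
  induction hv using Submodule.iSup_induction' with
  | mem μ x hx =>
    have hgx := hf.map_mem_eigenspace_of_commute_pow hg hx
    rw [Module.End.mem_eigenspace_iff] at hx hgx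
    rw [Module.End.mul_apply, Module.End.mul_apply, hx, hgx, map_smul]
  | zero => simp only [map_zero]
  | add x y _ _ hx hy => rw [map_add, map_add, hx, hy]
end

section
/- Let k be a field of characteristic p > 0, V a k-vector space, f a diagonalizable linear endomorphism of V, λ ∈ k, and q = p^n for some natural number n. Then the eigenspace of f^q for the eigenvalue λ^q equals the eigenspace of f for the eigenvalue λ. -/
theorem Module.End.eigenspace_le_eigenspace_pow {R M : Type*} [CommRing R] [AddCommGroup M]
    [Module R M] (f : Module.End R M) (μ : R) (m : ℕ) :
    f.eigenspace μ ≤ (f ^ m).eigenspace (μ ^ m) := by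
  intro v hv
  rw [Module.End.mem_eigenspace_iff] at hv ⊢
  induction m with
  | zero => simp
  | succ m ih => rw [pow_succ', Module.End.mul_apply, ih, map_smul, hv, smul_smul, pow_succ]

theorem Module.End.eigenspace_pow_eq_of_injective {k V : Type*} [Field k] [AddCommGroup V]
    [Module k V] (f : Module.End k V) (hdiag : ⨆ μ : k, f.eigenspace μ = ⊤) {m : ℕ}
    (hm : Function.Injective fun μ : k ↦ μ ^ m) (μ : k) :
    (f ^ m).eigenspace (μ ^ m) = f.eigenspace μ := by
  have hind : iSupIndep fun ν : k ↦ (f ^ m).eigenspace (ν ^ m) :=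
    (f ^ m).eigenspaces_iSupIndep.comp hm
  have hle : f.eigenspace ≤ fun ν : k ↦ (f ^ m).eigenspace (ν ^ m) :=
    fun ν ↦ f.eigenspace_le_eigenspace_pow ν m
  exact (congrFun ((hind.le_iff_eq_of_iSup_eq_top hdiag).1 hle) μ).symm


/-- Let `k` be a field of characteristic `p > 0`, `V` a `k`-vector space, `f` a
diagonalizable endomorphism of `V`, `λ ∈ k`, and `q = p ^ n`.  Then the eigenspace of
`f ^ q` for the eigenvalue `λ ^ q` equals the eigenspace of `f` for `λ`. -/
theorem stmt3 (k V : Type*) [Field k] [AddCommGroup V] [Module k V]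
    (p : ℕ) (hp : 0 < p) [CharP k p]
    (f : Module.End k V)
    (hdiag : ⨆ μ : k, f.eigenspace μ = ⊤)
    (lam : k) (n : ℕ) :
    (f ^ p ^ n).eigenspace (lam ^ p ^ n) = f.eigenspace lam := by
  have : Fact p.Prime := ⟨(CharP.char_is_prime_or_zero k p).resolve_right hp.ne'⟩
  exact f.eigenspace_pow_eq_of_injective hdiag (iterateFrobenius_inj k p n) lam
end

section
/- Let F be a field, Ω an algebraic closure of F, and E the separable closure of F inside Ω. Let A be an n×n matrix with entries in F, and suppose S and N are n×n matrices with entries in E such that: (i) the image of A in M_n(E) equals S + N; (ii) S·N = N·S; (iii) N is nilpotent; (iv) the image of S in M_n(Ω) is diagonalizable (semisimple). Then every entry of S and of N lies in (the image of) F; that is, there exist matrices S₀, N₀ over F whose images in M_n(E) are S and N. -/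
open Polynomial in
/-- A diagonalizable endomorphism is annihilated by a squarefree polynomial. -/
theorem Module.End.exists_squarefree_aeval_eq_zero_of_iSup_eigenspace_eq_top
    {K V : Type*} [Field K] [AddCommGroup V] [Module K V] [FiniteDimensional K V]
    {f : Module.End K V} (hf : ⨆ μ : K, f.eigenspace μ = ⊤) :
    ∃ p : K[X], Squarefree p ∧ aeval f p = 0 := by
  classical
  have hfin : {μ | f.HasEigenvalue μ}.Finite := f.finite_hasEigenvalue
  refine ⟨∏ μ ∈ hfin.toFinset, (X - C μ),
    (separable_prod_X_sub_C_iff' (f := id).mpr fun _ _ _ _ h ↦ h).squarefree, ?_⟩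
  rw [← LinearMap.ker_eq_top, eq_top_iff, ← hf]
  refine iSup_le fun μ v hv ↦ ?_
  rw [LinearMap.mem_ker]
  by_cases hv0 : v = 0
  · simp [hv0]
  have hev : f.HasEigenvector μ v := ⟨hv, hv0⟩
  have hμ : μ ∈ hfin.toFinset := by
    simpa using Module.End.hasEigenvalue_of_hasEigenvector hev
  rw [Module.End.aeval_apply_of_hasEigenvector hev, eval_prod,
    Finset.prod_eq_zero hμ (by simp), zero_smul]

open Polynomial in
/-- A field automorphism of a perfect field preserves annihilation of a matrix by a squarefree
polynomial. -/
theorem Matrix.exists_squarefree_aeval_map_eq_zero {ι K : Type*} [Fintype ι] [DecidableEq ι]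
    [Field K] [PerfectField K] {M : Matrix ι ι K} (τ : K ≃+* K)
    (hM : ∃ p : K[X], Squarefree p ∧ aeval M p = 0) :
    ∃ p : K[X], Squarefree p ∧ aeval (M.map τ) p = 0 := by
  obtain ⟨p, hp, hpM⟩ := hM
  refine ⟨p.map (τ : K →+* K), ?_, ?_⟩
  · exact (PerfectField.separable_iff_squarefree.mpr hp).map.squarefree
  · have h := Polynomial.map_aeval_eq_aeval_map (φ := (τ : K →+* K))
      (ψ := (τ : K →+* K).mapMatrix) (by
        ext a i j
        simp [Matrix.algebraMap_matrix_apply, apply_ite τ]) p M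
    rw [hpM, map_zero] at h
    exact h.symm

open Polynomial in
/-- Uniqueness of the additive Jordan decomposition for matrices over a perfect field. -/
theorem Matrix.eq_of_jordan_decomposition {ι K : Type*} [Fintype ι] [DecidableEq ι]
    [Field K] [PerfectField K] {S N S' N' : Matrix ι ι K}
    (hS : ∃ p : K[X], Squarefree p ∧ aeval S p = 0)
    (hS' : ∃ p : K[X], Squarefree p ∧ aeval S' p = 0)
    (hN : IsNilpotent N) (hN' : IsNilpotent N')
    (hc : Commute N S) (hc' : Commute N' S') (h : N + S = N' + S') : S = S' := by
  let e := Matrix.toLinAlgEquiv' (R := K) (n := ι)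
  have hss : ∀ {M : Matrix ι ι K}, (∃ p : K[X], Squarefree p ∧ aeval M p = 0) →
      Module.End.IsSemisimple (e M) := by
    rintro M ⟨p, hp, hpM⟩
    refine Module.End.isSemisimple_of_squarefree_aeval_eq_zero hp ?_
    rw [aeval_algHom_apply, hpM, map_zero]
  exact e.injective (Module.End.isNilpotent_isSemisimple_unique (hN.map e) (hss hS)
    (hN'.map e) (hss hS') (hc.map e) (hc'.map e) (by simp only [← map_add, h])).2

/-- A matrix over a Galois extension fixed by the Galois group is defined over the base field. -/
theorem Matrix.exists_map_algebraMap_eq_of_forall_map_eq {ι κ F E : Type*} [Field F] [Field E]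
    [Algebra F E] [IsGalois F E] {M : Matrix ι κ E} (hM : ∀ σ : Gal(E/F), M.map σ = M) :
    ∃ M₀ : Matrix ι κ F, M₀.map (algebraMap F E) = M := by
  have h : ∀ i j, ∃ a, algebraMap F E a = M i j := fun i j ↦
    (InfiniteGalois.mem_range_algebraMap_iff_fixed _).mpr fun σ ↦ congr_fun₂ (hM σ) i j
  choose M₀ hM₀ using h
  exact ⟨Matrix.of M₀, by ext i j; simp [hM₀]⟩


/-- Let `F` be a field, `Ω` an algebraic closure of `F`, and `E` the separable closure of
`F` inside `Ω`.  If `A` is an `n × n` matrix over `F`, and `S`, `N` are matrices over `E`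
with `A = S + N` (in `M_n E`), `S * N = N * S`, `N` nilpotent, and `S` diagonalizable
(semisimple) over `Ω`, then `S` and `N` come from matrices over `F`. -/
theorem stmt4 (F : Type*) [Field F] (n : ℕ)
    (Ω : Type*) [Field Ω] [Algebra F Ω] [IsAlgClosure F Ω]
    (E : IntermediateField F Ω) (hE : E = separableClosure F Ω)
    (A : Matrix (Fin n) (Fin n) F)
    (S N : Matrix (Fin n) (Fin n) E)
    (hSN : A.map (algebraMap F E) = S + N)
    (hcomm : S * N = N * S)
    (hN : IsNilpotent N)
    (hS : ⨆ μ : Ω, Module.End.eigenspace ((S.map (algebraMap E Ω)).mulVecLin) μ = ⊤) :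
    (∃ S₀ : Matrix (Fin n) (Fin n) F, S₀.map (algebraMap F E) = S) ∧
    (∃ N₀ : Matrix (Fin n) (Fin n) F, N₀.map (algebraMap F E) = N) := by
  have hclosed : IsAlgClosed Ω := IsAlgClosure.isAlgClosed F
  have hnormal : Normal F Ω := IsAlgClosure.normal F Ω
  have hgalois : IsGalois F E := hE ▸ separableClosure.isGalois F Ω
  have hss : ∃ p : Polynomial Ω, Squarefree p ∧
      Polynomial.aeval (S.map (algebraMap E Ω)) p = 0 := by
    obtain ⟨p, hp, hpS⟩ :=
      Module.End.exists_squarefree_aeval_eq_zero_of_iSup_eigenspace_eq_top hS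
    refine ⟨p, hp, (Matrix.toLinAlgEquiv' (R := Ω)).injective ?_⟩
    rw [map_zero, ← Polynomial.aeval_algHom_apply]
    exact hpS
  have hfixed : ∀ σ : Gal(E/F), S.map σ = S := by
    intro σ
    let τ : Gal(Ω/F) := σ.liftNormal Ω
    let a := (algebraMap E Ω).mapMatrix (m := Fin n)
    let s := (σ : E →+* E).mapMatrix (m := Fin n)
    have hτ : a (s S) = (a S).map τ.toRingEquiv := by
      ext i j
      exact (σ.liftNormal_commutes Ω (S i j)).symm
    have hA : s S + s N = S + N := by
      rw [← map_add, ← hSN]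
      ext i j
      simp [s]
    refine Matrix.map_injective (algebraMap E Ω).injective ?_
    refine Matrix.eq_of_jordan_decomposition (N := a (s N)) (N' := a N) ?_ hss
      ((hN.map s).map a) (hN.map a) ?_ ?_ ?_
    · change ∃ p : Polynomial Ω, Squarefree p ∧ Polynomial.aeval (a (s S)) p = 0
      rw [hτ]
      exact Matrix.exists_squarefree_aeval_map_eq_zero τ.toRingEquiv hss
    · exact ((show Commute N S from hcomm.symm).map s).map a
    · exact (show Commute N S from hcomm.symm).map a
    · change a (s N) + a (s S) = a N + a S
      rw [← map_add a, add_comm (s N), hA, map_add, add_comm]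
  obtain ⟨S₀, hS₀⟩ := Matrix.exists_map_algebraMap_eq_of_forall_map_eq hfixed
  refine ⟨⟨S₀, hS₀⟩, A - S₀, ?_⟩
  rw [Matrix.map_sub _ (map_sub _), hSN, hS₀, add_sub_cancel_left]
end

section
/- Let F be a field, Ω an algebraic closure of F, and E the separable closure of F inside Ω. Let A be an invertible n×n matrix with entries in F, and suppose s and u are n×n matrices with entries in E such that: (i) the image of A in M_n(E) equals s·u and also u·s; (ii) u − 1 is nilpotent (u is unipotent); (iii) the image of s in M_n(Ω) is diagonalizable (semisimple). Then every entry of s and of u lies in (the image of) F. -/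
open Polynomial

/-- An endomorphism whose eigenspaces span the whole space is semisimple. -/
theorem Module.End.isSemisimple_of_iSup_eigenspace_eq_top {K V : Type*} [Field K]
    [AddCommGroup V] [Module K V] [FiniteDimensional K V] {f : Module.End K V}
    (hf : ⨆ μ : K, f.eigenspace μ = ⊤) : f.IsSemisimple := by
  classical
  let p : K[X] := ∏ μ ∈ (minpoly K f).roots.toFinset, (X - C μ)
  have hp : Squarefree p :=
    (separable_prod_X_sub_C_iff' (f := id).mpr fun _ _ _ _ h => h).squarefree
  refine isSemisimple_of_squarefree_aeval_eq_zero hp ?_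
  rw [← LinearMap.ker_eq_top, eq_top_iff, ← hf, iSup_le_iff]
  intro μ x hx
  rw [LinearMap.mem_ker]
  by_cases hx0 : x = 0
  · simp [hx0]
  have hev : f.HasEigenvector μ x := ⟨hx, hx0⟩
  have hroot : (minpoly K f).IsRoot μ :=
    isRoot_of_hasEigenvalue (hasEigenvalue_of_hasEigenvector hev)
  have hμ : μ ∈ (minpoly K f).roots.toFinset := by
    rw [Multiset.mem_toFinset, mem_roots (minpoly.ne_zero_of_finite K f)]
    exact hroot
  rw [aeval_apply_of_hasEigenvector hev, eval_prod,
    Finset.prod_eq_zero hμ (by simp), zero_smul]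

/-- Semisimplicity of matrices over a perfect field is preserved by field homomorphisms. -/
theorem Matrix.isSemisimple_toLinAlgEquiv'_map {K L n : Type*} [Field K] [Field L] [PerfectField K]
    [Fintype n] [DecidableEq n] (σ : K →+* L) {s : Matrix n n K}
    (hs : Module.End.IsSemisimple (toLinAlgEquiv' s)) :
    Module.End.IsSemisimple (toLinAlgEquiv' (s.map σ)) := by
  have hsep := PerfectField.separable_iff_squarefree.mpr hs.minpoly_squarefree
  refine Module.End.isSemisimple_of_squarefree_aeval_eq_zero (hsep.map (f := σ)).squarefree ?_
  have h : aeval s (minpoly K (toLinAlgEquiv' s)) = 0 := by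
    apply (toLinAlgEquiv' (R := K) (n := n)).injective
    rw [← aeval_algHom_apply, map_zero, minpoly.aeval]
  rw [aeval_algHom_apply, ← RingHom.mapMatrix_apply, ← map_aeval_eq_aeval_map, h, map_zero,
    map_zero]
  ext i j
  simp [Matrix.algebraMap_matrix_apply, apply_ite σ]

/-- Uniqueness of the semisimple part in the multiplicative Jordan decomposition. -/
theorem Module.End.eq_of_isSemisimple_mul_unipotent {K V : Type*} [Field K] [PerfectField K]
    [AddCommGroup V] [Module K V] [FiniteDimensional K V] {s u s' u' : Module.End K V}
    (hs : s.IsSemisimple) (hs' : s'.IsSemisimple)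
    (hu : IsNilpotent (u - 1)) (hu' : IsNilpotent (u' - 1))
    (hc : Commute s u) (hc' : Commute s' u') (h : s * u = s' * u') : s = s' := by
  have hd : Commute s (u - 1) := hc.sub_right (Commute.one_right s)
  have hd' : Commute s' (u' - 1) := hc'.sub_right (Commute.one_right s')
  refine (isNilpotent_isSemisimple_unique (hd.isNilpotent_mul_left hu) hs
    (hd'.isNilpotent_mul_left hu') hs' ((Commute.refl s).mul_left hd.symm)
    ((Commute.refl s').mul_left hd'.symm) ?_).2
  simpa [mul_sub] using h

/-- A matrix fixed by the Galois group is defined over the base field. -/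
theorem Matrix.exists_map_algebraMap_eq_of_fixed {F E n : Type*} [Field F] [Field E] [Algebra F E]
    [IsGalois F E] (M : Matrix n n E) (h : ∀ f : Gal(E/F), M.map f = M) :
    ∃ M₀ : Matrix n n F, M₀.map (algebraMap F E) = M := by
  have hM (i j : n) : M i j ∈ Set.range (algebraMap F E) :=
    (InfiniteGalois.mem_range_algebraMap_iff_fixed _).mpr fun f => congrFun₂ (h f) i j
  choose M₀ hM₀ using hM
  exact ⟨Matrix.of M₀, Matrix.ext hM₀⟩

/-- Let `F` be a field, `Ω` an algebraic closure of `F`, and `E` the separable closure of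
`F` inside `Ω`.  If `A` is an invertible `n × n` matrix over `F`, and `s`, `u` are matrices
over `E` with `A = s * u = u * s` (in `M_n E`), `u` unipotent (`u - 1` nilpotent), and `s`
diagonalizable (semisimple) over `Ω`, then `s` and `u` come from matrices over `F`. -/
theorem stmt5 (F : Type*) [Field F] (n : ℕ)
    (Ω : Type*) [Field Ω] [Algebra F Ω] [IsAlgClosure F Ω]
    (E : IntermediateField F Ω) (hE : E = separableClosure F Ω)
    (A : Matrix (Fin n) (Fin n) F) (hA : IsUnit A)
    (s u : Matrix (Fin n) (Fin n) E)
    (hsu : A.map (algebraMap F E) = s * u)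
    (hus : A.map (algebraMap F E) = u * s)
    (hu : IsNilpotent (u - 1))
    (hs : ⨆ μ : Ω, Module.End.eigenspace ((s.map (algebraMap E Ω)).mulVecLin) μ = ⊤) :
    (∃ s₀ : Matrix (Fin n) (Fin n) F, s₀.map (algebraMap F E) = s) ∧
    (∃ u₀ : Matrix (Fin n) (Fin n) F, u₀.map (algebraMap F E) = u) := by
  have : IsAlgClosed Ω := IsAlgClosure.isAlgClosed F
  have : Normal F Ω := IsAlgClosure.normal F Ω
  have : IsGalois F E := hE ▸ separableClosure.isGalois F Ω
  have hss : Module.End.IsSemisimple (Matrix.toLinAlgEquiv' (s.map (algebraMap E Ω))) :=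
    Module.End.isSemisimple_of_iSup_eigenspace_eq_top hs
  let φ : Matrix (Fin n) (Fin n) E →+* Module.End Ω (Fin n → Ω) :=
    (Matrix.toLinAlgEquiv' (R := Ω) (n := Fin n)).toRingEquiv.toRingHom.comp
      (algebraMap E Ω).mapMatrix
  have hφ : Function.Injective φ :=
    (Matrix.toLinAlgEquiv' (R := Ω) (n := Fin n)).injective.comp
      (Matrix.map_injective (algebraMap E Ω).injective)
  have hcomm : Commute s u := hsu.symm.trans hus
  have hprod (f : Gal(E/F)) : s * u = s.map f * u.map f := by
    calc s * u = (s * u).map f := by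
          rw [← hsu]
          ext i j
          simp
      _ = s.map f * u.map f := Matrix.map_mul (f := (f : E →+* E))
  have hfix (f : Gal(E/F)) : s.map f = s := by
    have hssf : (φ (s.map f)).IsSemisimple := by
      convert Matrix.isSemisimple_toLinAlgEquiv'_map (f.liftNormal Ω : Ω →+* Ω) hss using 1
      refine congrArg Matrix.toLinAlgEquiv' ?_
      ext i j
      exact (f.liftNormal_commutes Ω (s i j)).symm
    have huf : IsNilpotent (u.map f - 1) := by
      have := hu.map ((f : E →+* E).mapMatrix (m := Fin n))
      rwa [map_sub, map_one] at this
    have hcommf : Commute (s.map f) (u.map f) := hcomm.map ((f : E →+* E).mapMatrix (m := Fin n))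
    refine (hφ (Module.End.eq_of_isSemisimple_mul_unipotent (u := φ u) (u' := φ (u.map f))
      hss hssf ?_ ?_ (hcomm.map φ) (hcommf.map φ) ?_)).symm
    · simpa using hu.map φ
    · simpa using huf.map φ
    · rw [← map_mul, ← map_mul, hprod f]
  have hunit : IsUnit s := by
    have : IsUnit (s * u) := hsu ▸ hA.map (algebraMap F E).mapMatrix
    exact (hcomm.isUnit_mul_iff.mp this).1
  refine ⟨s.exists_map_algebraMap_eq_of_fixed hfix, u.exists_map_algebraMap_eq_of_fixed fun f => ?_⟩
  refine (hunit.mul_left_cancel ?_).symm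
  rw [hprod f, hfix f]
end

section
/- Let p be an odd prime, κ a field of characteristic p, and F = κ((t)) the field of formal Laurent series over κ. Let H = { y^p − y − t·z^p : y, z ∈ F }, an additive subgroup of F. Then for every integer n ≥ 1, the element t^{−np+2} does not lie in H, and for all integers n > m ≥ 1, the element t^{−np+2} − t^{−mp+2} does not lie in H. Consequently the cosets t^{−np+2} + H, for n ≥ 1, are pairwise distinct and all nontrivial, so the quotient group F/H is infinite. -/
theorem PowerSeries.coeff_pow_char {R : Type*} [CommRing R] {p : ℕ} (hp : p ≠ 0) [ExpChar R p]
    (f : PowerSeries R) (n : ℕ) :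
    (f ^ p).coeff n = if p ∣ n then f.coeff (n / p) ^ p else 0 := by
  have h : PowerSeries.map (frobenius R p) (f.expand p hp) = f ^ p :=
    MvPowerSeries.map_frobenius_expand p hp
  rw [← h, PowerSeries.coeff_map, PowerSeries.coeff_expand]
  split_ifs <;> simp [frobenius_def, hp]

namespace LaurentSeries

open HahnSeries

variable {R : Type*} [CommRing R] {p : ℕ}

theorem coeff_pow_char_mul (hp : p ≠ 0) [ExpChar R p] (y : LaurentSeries R) (k : ℤ) :
    (y ^ p).coeff (p * k) = y.coeff k ^ p := by
  have hp' : (0 : ℤ) < p := by positivity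
  conv_lhs => rw [← single_order_mul_powerSeriesPart y]
  conv_rhs => rw [← single_order_mul_powerSeriesPart y]
  rw [mul_pow, single_pow, ← map_pow, coeff_single_mul, coeff_single_mul, one_pow, one_mul,
    one_mul, nsmul_eq_mul, ← mul_sub, PowerSeries.coeff_coe, PowerSeries.coeff_coe, PowerSeries.coeff_pow_char hp,
    Int.natAbs_mul, Int.natAbs_natCast, if_pos (dvd_mul_right _ _),
    Nat.mul_div_cancel_left _ (Nat.pos_of_ne_zero hp)]
  by_cases h : k - y.order < 0
  · rw [if_pos h, if_pos (mul_neg_of_pos_of_neg hp' h), zero_pow hp]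
  · rw [if_neg h, if_neg (not_lt.mpr (mul_nonneg hp'.le (not_lt.mp h)))]

theorem coeff_pow_char_of_not_dvd (hp : p ≠ 0) [ExpChar R p] (y : LaurentSeries R) {j : ℤ}
    (hj : ¬ (p : ℤ) ∣ j) : (y ^ p).coeff j = 0 := by
  conv_lhs => rw [← single_order_mul_powerSeriesPart y]
  rw [mul_pow, single_pow, ← map_pow, coeff_single_mul, one_pow, one_mul, nsmul_eq_mul, PowerSeries.coeff_coe,
    PowerSeries.coeff_pow_char hp, if_neg (c := p ∣ _), ite_self]
  rwa [← Int.natCast_dvd, dvd_sub_left (dvd_mul_right _ _)]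

/-- If `x = y ^ p - y - t * z ^ p` has no monomials with exponent divisible by `p`, then it has no
monomials with negative exponent outside the residue classes `0` and `1` modulo `p`: such a monomial
of exponent `e` would force `y` to have monomials of exponents `e, p * e, p ^ 2 * e, …`. -/
theorem coeff_pow_char_sub_sub_eq_zero [IsReduced R] (hp : p.Prime) [ExpChar R p]
    {x y z : LaurentSeries R} (hx : x = y ^ p - y - single (1 : ℤ) (1 : R) * z ^ p)
    (hx0 : ∀ j : ℤ, (p : ℤ) ∣ j → x.coeff j = 0) {e : ℤ} (he : e < 0) (he0 : ¬ (p : ℤ) ∣ e)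
    (he1 : ¬ (p : ℤ) ∣ e - 1) : x.coeff e = 0 := by
  have hp0 := hp.ne_zero
  have hcoeff (j : ℤ) : x.coeff j = (y ^ p).coeff j - y.coeff j - (z ^ p).coeff (j - 1) := by
    rw [hx, coeff_sub, coeff_sub, coeff_single_mul, one_mul]
  have hstep (k : ℤ) : y.coeff (p * k) = y.coeff k ^ p := by
    have h := hcoeff (p * k)
    have hnd : ¬ (p : ℤ) ∣ p * k - 1 := by
      rw [dvd_sub_right (dvd_mul_right _ _)]
      exact_mod_cast hp.one_lt.ne' ∘ Nat.dvd_one.mp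
    rw [hx0 _ (dvd_mul_right _ _), coeff_pow_char_mul hp0, coeff_pow_char_of_not_dvd hp0 z hnd,
      sub_zero] at h
    exact (sub_eq_zero.mp h.symm).symm
  rw [hcoeff, coeff_pow_char_of_not_dvd hp0 y he0, coeff_pow_char_of_not_dvd hp0 z he1, sub_zero,
    zero_sub, neg_eq_zero]
  by_contra hy
  have hiter (k : ℕ) : y.coeff (p ^ k * e) ≠ 0 := by
    induction k with
    | zero => simpa using hy
    | succ k ih =>
      rw [pow_succ', mul_assoc, hstep]
      exact pow_ne_zero p ih
  have hle := order_le_of_coeff_ne_zero (hiter y.order.natAbs)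
  have hlt : (y.order.natAbs : ℤ) < p ^ y.order.natAbs := by
    exact_mod_cast Nat.lt_pow_self hp.one_lt
  nlinarith [neg_abs_le y.order, Int.natCast_natAbs y.order]

end LaurentSeries


/-- Let `p` be an odd prime, `κ` a field of characteristic `p`, and `F = κ((t))`.
Let `H = { y^p - y - t·z^p : y, z ∈ F }`, an additive subgroup of `F`.  Then for `n ≥ 1`
the element `t^(-np+2)` does not lie in `H`; for `n > m ≥ 1` the difference
`t^(-np+2) - t^(-mp+2)` does not lie in `H`; and consequently the quotient group `F/H`
is infinite. -/
theorem stmt8 (p : ℕ) (hp : p.Prime) (hodd : Odd p) (κ : Type*) [Field κ] [CharP κ p] :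
    letI F := LaurentSeries κ
    letI t : F := HahnSeries.single (1 : ℤ) (1 : κ)
    letI S : Set F := {x | ∃ y z : F, x = y ^ p - y - t * z ^ p}
    (∀ n : ℕ, 1 ≤ n →
      (HahnSeries.single (-(n : ℤ) * p + 2) (1 : κ) : F) ∉ S) ∧
    (∀ n m : ℕ, 1 ≤ m → m < n →
      (HahnSeries.single (-(n : ℤ) * p + 2) (1 : κ) : F)
        - (HahnSeries.single (-(m : ℤ) * p + 2) (1 : κ) : F) ∉ S) ∧
    (∀ H : AddSubgroup F, (H : Set F) = S → Infinite (F ⧸ H)) := by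
  have : Fact p.Prime := ⟨hp⟩
  have : ExpChar κ p := .prime hp
  have hp2 : ¬ (p : ℤ) ∣ 2 := by
    intro h
    have := (Nat.prime_dvd_prime_iff_eq hp Nat.prime_two).mp (by exact_mod_cast h)
    subst this
    exact absurd hodd (by decide)
  have hp3 : (3 : ℤ) ≤ p := by
    have := hp.two_le
    have : p ≠ 2 := by rintro rfl; exact hp2 dvd_rfl
    lia
  have hnd (n : ℕ) : ¬ (p : ℤ) ∣ -(n : ℤ) * p + 2 := by
    rwa [dvd_add_right (dvd_mul_left _ _)]
  have hnd1 (n : ℕ) : ¬ (p : ℤ) ∣ -(n : ℤ) * p + 2 - 1 := by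
    rw [add_sub_assoc, dvd_add_right (dvd_mul_left _ _)]
    intro h
    have := Int.le_of_dvd (by norm_num) h
    lia
  have hneg (n : ℕ) (hn : 1 ≤ n) : -(n : ℤ) * p + 2 < 0 := by
    have : (1 : ℤ) ≤ n := by exact_mod_cast hn
    nlinarith
  have hcoeff (n : ℕ) (j : ℤ) (hj : (p : ℤ) ∣ j) :
      (HahnSeries.single (-(n : ℤ) * p + 2) (1 : κ)).coeff j = 0 :=
    HahnSeries.coeff_single_of_ne (by rintro rfl; exact hnd n hj)
  have hdiff (n m : ℕ) (hm : 1 ≤ m) (hmn : m < n) (y z : LaurentSeries κ) :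
      (HahnSeries.single (-(n : ℤ) * p + 2) (1 : κ) : LaurentSeries κ)
        - HahnSeries.single (-(m : ℤ) * p + 2) (1 : κ)
        ≠ y ^ p - y - HahnSeries.single (1 : ℤ) (1 : κ) * z ^ p := by
    intro h
    have h0 := LaurentSeries.coeff_pow_char_sub_sub_eq_zero hp h
      (fun j hj ↦ by rw [HahnSeries.coeff_sub, hcoeff n j hj, hcoeff m j hj, sub_zero])
      (hneg n (by lia)) (hnd n) (hnd1 n)
    have hne : -(n : ℤ) * p + 2 ≠ -(m : ℤ) * p + 2 := by
      have : (m : ℤ) < n := by exact_mod_cast hmn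
      nlinarith
    rw [HahnSeries.coeff_sub, HahnSeries.coeff_single_same, HahnSeries.coeff_single_of_ne hne,
      sub_zero] at h0
    exact one_ne_zero h0
  refine ⟨?_, ?_, ?_⟩
  · rintro n hn ⟨y, z, h⟩
    have h0 := LaurentSeries.coeff_pow_char_sub_sub_eq_zero hp h (hcoeff n) (hneg n hn) (hnd n)
      (hnd1 n)
    rw [HahnSeries.coeff_single_same] at h0
    exact one_ne_zero h0
  · rintro n m hm hmn ⟨y, z, h⟩
    exact hdiff n m hm hmn y z h
  · intro H hH
    refine Infinite.of_injective (fun n : ℕ ↦ (QuotientAddGroup.mk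
      (HahnSeries.single (-((n + 1 : ℕ) : ℤ) * p + 2) (1 : κ) : LaurentSeries κ) :
        LaurentSeries κ ⧸ H)) (.of_lt_imp_ne fun m n hmn h ↦ ?_)
    have hmem := (QuotientAddGroup.eq_iff_sub_mem.mp h.symm)
    rw [← SetLike.mem_coe, hH] at hmem
    obtain ⟨y, z, h⟩ := hmem
    exact hdiff (n + 1) (m + 1) (by lia) (by lia) y z h
end

section
/- Let F be a field of characteristic p > 0 and let n be a positive integer with n < p. Then every n×n matrix A with entries in F admits an additive Jordan decomposition defined over F: there exist n×n matrices S and N over F such that A = S + N, S·N = N·S, N is nilpotent, and the image of S in M_n(F̄) is diagonalizable (semisimple), where F̄ is an algebraic closure of F. -/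
open Polynomial in
/-- An irreducible polynomial of degree less than the positive characteristic is separable. -/
theorem Irreducible.separable_of_natDegree_lt_char {F : Type*} [Field F] (p : ℕ) [CharP F p]
    {q : F[X]} (hq : Irreducible q) (hqp : q.natDegree < p) : q.Separable := by
  obtain h | ⟨-, g, hg, rfl⟩ := Polynomial.separable_or p hq
  · exact h
  · rw [natDegree_expand] at hqp
    exact absurd (Nat.le_mul_of_pos_left p hg.natDegree_pos) hqp.not_ge

open Polynomial in
/-- A squarefree polynomial of degree less than the positive characteristic is separable. -/
theorem Squarefree.separable_of_natDegree_lt_char {F : Type*} [Field F] (p : ℕ) [CharP F p]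
    {f : F[X]} (hf : Squarefree f) (hfp : f.natDegree < p) : f.Separable := by
  refine isCoprime_of_irreducible_dvd (hf.ne_zero ·.1) ?_
  rintro q (hq : Irreducible q) ⟨r, rfl⟩ (dvd : q ∣ derivative (q * r))
  have hsep : q.Separable := hq.separable_of_natDegree_lt_char p <|
    (natDegree_le_of_dvd (dvd_mul_right q r) hf.ne_zero).trans_lt hfp
  rw [derivative_mul, dvd_add_left (dvd_mul_right q _)] at dvd
  exact hq.1 (hf _ <| mul_dvd_mul_left _ (hsep.dvd_of_dvd_mul_left dvd))

open Polynomial in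
/-- Over an algebraically closed extension, a matrix annihilated by a separable polynomial with
coefficients in the base field is diagonalizable. -/
theorem Matrix.iSup_eigenspace_map_eq_top_of_separable {F K ι : Type*} [Field F] [Field K]
    [Algebra F K] [IsAlgClosed K] [Fintype ι] [DecidableEq ι] {S : Matrix ι ι F} {f : F[X]}
    (hf : f.Separable) (hS : aeval S f = 0) :
    ⨆ μ : K, Module.End.eigenspace (S.map (algebraMap F K)).mulVecLin μ = ⊤ := by
  refine Module.End.IsSemisimple.iSup_eigenspace_eq_top <|
    Module.End.isSemisimple_of_squarefree_aeval_eq_zero (hf.map (f := algebraMap F K)).squarefree ?_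
  have h : aeval (S.map (algebraMap F K)) f = 0 :=
    (aeval_algHom_apply (Algebra.ofId F K).mapMatrix S f).trans (by rw [hS, map_zero])
  have h' := aeval_algHom_apply (Matrix.toLinAlgEquiv' (R := K) (n := ι))
    (S.map (algebraMap F K)) (f.map (algebraMap F K))
  rwa [aeval_map_algebraMap K (S.map (algebraMap F K)) f, h, map_zero] at h'

/-- Let `F` be a field of characteristic `p > 0` and `n` a positive integer with `n < p`.
Then every `n × n` matrix over `F` has an additive Jordan decomposition over `F`:
`A = S + N` with `S * N = N * S`, `N` nilpotent, and `S` diagonalizable (semisimple)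
over an algebraic closure `F̄`. -/
theorem stmt12 (F : Type*) [Field F] (p : ℕ) (hp : 0 < p) [CharP F p]
    (n : ℕ) (hn : 0 < n) (hnp : n < p)
    (A : Matrix (Fin n) (Fin n) F) :
    ∃ S N : Matrix (Fin n) (Fin n) F,
      A = S + N ∧ S * N = N * S ∧ IsNilpotent N ∧
      ⨆ μ : AlgebraicClosure F,
        Module.End.eigenspace ((S.map (algebraMap F (AlgebraicClosure F))).mulVecLin) μ = ⊤ := by
  let e := Matrix.toLinAlgEquiv' (R := F) (n := Fin n)
  have natDegree_lt (M : Matrix (Fin n) (Fin n) F) : (minpoly F M).natDegree < p := by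
    refine lt_of_le_of_lt ?_ hnp
    simpa using Polynomial.natDegree_le_of_dvd M.minpoly_dvd_charpoly M.charpoly_monic.ne_zero
  obtain ⟨P, k, hP, hPA, hAP⟩ := exists_squarefree_dvd_pow_of_ne_zero
    (minpoly.ne_zero (Algebra.IsIntegral.isIntegral (R := F) A))
  have hPsep : P.Separable := hP.separable_of_natDegree_lt_char p <|
    (Polynomial.natDegree_le_of_dvd hPA
      (minpoly.ne_zero (Algebra.IsIntegral.isIntegral A))).trans_lt (natDegree_lt A)
  rw [← minpoly.algEquiv_eq e] at hAP
  obtain ⟨N, hN, S, hS, hNnil, hSss, hA⟩ :=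
    Module.End.exists_isNilpotent_isSemisimple_of_separable_of_dvd_pow hPsep hAP
  have hcomm : Commute S N := Algebra.commute_of_mem_adjoin_singleton_of_commute hN
    (Algebra.commute_of_mem_adjoin_self hS).symm
  have hSsep : (minpoly F (e.symm S)).Separable := by
    refine Squarefree.separable_of_natDegree_lt_char p ?_ (natDegree_lt _)
    rw [minpoly.algEquiv_eq]
    exact hSss.minpoly_squarefree
  refine ⟨e.symm S, e.symm N, ?_, ?_, hNnil.map e.symm,
    Matrix.iSup_eigenspace_map_eq_top_of_separable hSsep (minpoly.aeval F _)⟩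
  · rw [← map_add, add_comm S N, ← hA, AlgEquiv.symm_apply_apply]
  · rw [← map_mul, ← map_mul, hcomm.eq]
end
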